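/- Suppose α is a silhouette curve with axis d (i.e. d is a unit vector with ⟪N(s), d⟫ = 0 for all s), k_n(s)² + τ_g(s)² > 0 for all s, and τ_g(s) = 0 for all s. Then B'(s) = 0 for all s (B is a constant vector) and there exists ε ∈ {1, −1} such that d = ε·B(s) for all s (the axis of the silhouette is ±B). -/

import Mathlib

open scoped RealInnerProductSpace

noncomputable section

/-- The cross product on `EuclideanSpace ℝ (Fin 3)`. -/
def cross3 (u v : EuclideanSpace ℝ (Fin 3)) : EuclideanSpace ℝ (Fin 3) :=
  (EuclideanSpace.equiv (Fin 3) ℝ).symm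
    (crossProduct ((EuclideanSpace.equiv (Fin 3) ℝ) u) ((EuclideanSpace.equiv (Fin 3) ℝ) v))

theorem inner_cross3_left (u v : EuclideanSpace ℝ (Fin 3)) : ⟪u, cross3 u v⟫ = 0 := by
  simp [cross3, PiLp.inner_apply, Fin.sum_univ_three, cross_apply]
  ring

theorem inner_cross3_right (u v : EuclideanSpace ℝ (Fin 3)) : ⟪v, cross3 u v⟫ = 0 := by
  simp [cross3, PiLp.inner_apply, Fin.sum_univ_three, cross_apply]
  ring

theorem inner_cross3_self (u v : EuclideanSpace ℝ (Fin 3)) :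
    ⟪cross3 u v, cross3 u v⟫ = ⟪u, u⟫ * ⟪v, v⟫ - ⟪u, v⟫ ^ 2 := by
  simp [cross3, PiLp.inner_apply, Fin.sum_univ_three, cross_apply,
    -inner_self_eq_norm_sq_to_K]
  ring

theorem orthonormal_cross3 {u v : EuclideanSpace ℝ (Fin 3)} (hu : ‖u‖ = 1) (hv : ‖v‖ = 1)
    (huv : ⟪u, v⟫ = 0) : Orthonormal ℝ ![u, v, cross3 u v] := by
  have hw : ‖cross3 u v‖ = 1 := by
    have h := inner_cross3_self u v
    simp only [real_inner_self_eq_norm_sq, hu, hv, huv] at h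
    nlinarith [norm_nonneg (cross3 u v)]
  have hvu : ⟪v, u⟫ = 0 := by rw [real_inner_comm, huv]
  have h₁ := inner_cross3_left u v
  have h₂ := inner_cross3_right u v
  have h₃ : ⟪cross3 u v, u⟫ = 0 := by rw [real_inner_comm, h₁]
  have h₄ : ⟪cross3 u v, v⟫ = 0 := by rw [real_inner_comm, h₂]
  constructor
  · intro i
    fin_cases i <;> simp [hu, hv, hw]
  · intro i j hij
    fin_cases i <;> fin_cases j <;> simp_all

theorem eq_sum_inner_smul_cross3 {u v : EuclideanSpace ℝ (Fin 3)} (hu : ‖u‖ = 1) (hv : ‖v‖ = 1)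
    (huv : ⟪u, v⟫ = 0) (x : EuclideanSpace ℝ (Fin 3)) :
    x = ⟪u, x⟫ • u + ⟪v, x⟫ • v + ⟪cross3 u v, x⟫ • cross3 u v := by
  have ho := orthonormal_cross3 hu hv huv
  let b := OrthonormalBasis.mk ho
    (ho.linearIndependent.span_eq_top_of_card_eq_finrank (by simp)).ge
  simpa [b, Fin.sum_univ_three] using (b.sum_repr' x).symm

theorem Differentiable.cross3 {u v : ℝ → EuclideanSpace ℝ (Fin 3)} (hu : Differentiable ℝ u)
    (hv : Differentiable ℝ v) : Differentiable ℝ fun s => cross3 (u s) (v s) := by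
  have hu' := differentiable_euclidean.1 hu
  have hv' := differentiable_euclidean.1 hv
  rw [differentiable_euclidean]
  intro i
  fin_cases i <;> simp [_root_.cross3, cross_apply] <;>
    exact ((hu' _).mul (hv' _)).sub ((hu' _).mul (hv' _))

theorem stmt12
    (α N : ℝ → EuclideanSpace ℝ (Fin 3))
    (hα : ContDiff ℝ (⊤ : ℕ∞) α) (hN : ContDiff ℝ (⊤ : ℕ∞) N)
    (hunit : ∀ s, ‖deriv α s‖ = 1)
    (hNunit : ∀ s, ‖N s‖ = 1)
    (hNT : ∀ s, ⟪N s, deriv α s⟫ = 0)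
    (T B : ℝ → EuclideanSpace ℝ (Fin 3))
    (hT : ∀ s, T s = deriv α s)
    (hB : ∀ s, B s = cross3 (N s) (T s))
    (kn kg τg : ℝ → ℝ)
    (hkn : ∀ s, kn s = ⟪deriv T s, N s⟫)
    (hkg : ∀ s, kg s = ⟪deriv T s, B s⟫)
    (hτg : ∀ s, τg s = ⟪deriv B s, N s⟫)
    (d : EuclideanSpace ℝ (Fin 3)) (hd : ‖d‖ = 1)
    (hsil : ∀ s, ⟪N s, d⟫ = 0)
    (hpos : ∀ s, 0 < kn s ^ 2 + τg s ^ 2)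
    (hloc : ∀ s, τg s = 0) :
    (∀ s, deriv B s = 0) ∧
      ∃ ε : ℝ, (ε = 1 ∨ ε = -1) ∧ ∀ s, d = ε • B s := by
  obtain rfl : T = deriv α := funext hT
  obtain rfl : B = fun s => cross3 (N s) (deriv α s) := funext hB
  have hNd : Differentiable ℝ N := hN.differentiable (by simp)
  have hTd : Differentiable ℝ (deriv α) :=
    ((contDiff_infty_iff_deriv (𝕜 := ℝ)).1 hα).2.differentiable (by simp)
  have hBd := hNd.cross3 hTd
  have inner_deriv {f g : ℝ → EuclideanSpace ℝ (Fin 3)} {c : ℝ} (hf : Differentiable ℝ f)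
      (hg : Differentiable ℝ g) (h : ∀ s, ⟪f s, g s⟫ = c) (s : ℝ) :
      ⟪f s, deriv g s⟫ + ⟪deriv f s, g s⟫ = 0 := by
    rw [← deriv_inner_apply (𝕜 := ℝ) (hf s) (hg s), funext h, deriv_const]
  have hTorth (s : ℝ) : ⟪deriv α s, d⟫ = 0 := by
    have hNN := inner_deriv hNd hNd (c := 1) (fun s => by simp [hNunit]) s
    have hNT' := inner_deriv hNd hTd hNT s
    have hNB := inner_deriv hNd hBd (fun s => inner_cross3_left _ _) s
    have hNd' := inner_deriv hNd (differentiable_const d) hsil s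
    have hk := hpos s
    have hτ := hloc s
    rw [hτg, real_inner_comm] at hτ
    rw [hloc, hkn, real_inner_comm] at hk
    have h₁ : ⟪N s, deriv N s⟫ = 0 := by
      linarith [real_inner_comm (N s) (deriv N s)]
    have h₂ : ⟪cross3 (N s) (deriv α s), deriv N s⟫ = 0 := by
      rw [real_inner_comm]
      linarith
    have h₃ := eq_sum_inner_smul_cross3 (hNunit s) (hunit s) (hNT s) (deriv N s)
    rw [h₁, h₂, zero_smul, zero_smul, zero_add, add_zero] at h₃
    have h₄ : ⟪deriv N s, d⟫ = 0 := by simpa using hNd'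
    rw [h₃, real_inner_smul_left, mul_eq_zero] at h₄
    refine h₄.resolve_left fun h => ?_
    rw [real_inner_comm] at h
    rw [h, add_zero] at hNT'
    simp [hNT'] at hk
  have hdB (s : ℝ) : d = ⟪cross3 (N s) (deriv α s), d⟫ • cross3 (N s) (deriv α s) := by
    simpa [hsil, hTorth] using eq_sum_inner_smul_cross3 (hNunit s) (hunit s) (hNT s) d
  have hsq (s : ℝ) : ⟪cross3 (N s) (deriv α s), d⟫ ^ 2 = 1 := by
    have h := congrArg (fun x => ⟪x, d⟫) (hdB s)
    simp only [real_inner_smul_left, real_inner_self_eq_norm_sq, hd] at h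
    linarith
  have hcont : Continuous fun s => ⟪cross3 (N s) (deriv α s), d⟫ :=
    hBd.continuous.inner continuous_const
  obtain ⟨ε, hε, hεB⟩ : ∃ ε : ℝ, (ε = 1 ∨ ε = -1) ∧
      ∀ s, ⟪cross3 (N s) (deriv α s), d⟫ = ε := by
    rcases isPreconnected_univ.eq_one_or_eq_neg_one_of_sq_eq hcont.continuousOn
      (fun s _ => hsq s) with h | h
    · exact ⟨1, Or.inl rfl, fun s => h (Set.mem_univ s)⟩
    · exact ⟨-1, Or.inr rfl, fun s => h (Set.mem_univ s)⟩
  have hd_eq (s : ℝ) : d = ε • cross3 (N s) (deriv α s) := hεB s ▸ hdB s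
  refine ⟨fun s => ?_, ε, hε, hd_eq⟩
  have hBconst : (fun s => cross3 (N s) (deriv α s)) = fun _ => ε • d := by
    funext t
    rw [hd_eq t]
    rcases hε with rfl | rfl <;> simp
  rw [hBconst, deriv_const]
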